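/- A nodal cubic threefold X ⊂ ℙ⁴ has at most 10 nodes. -/

import Mathlib

open MvPolynomial
open scoped LinearAlgebra.Projectivization

section BicubicCurves

open Polynomial

variable {K : Type*} [Field K]

/-- The discriminant of the binary cubic `a t³ + b t² + c t + d`. -/
def cubicDiscr {R : Type*} [CommRing R] (a b c d : R) : R :=
  b ^ 2 * c ^ 2 - 4 * a * c ^ 3 - 4 * b ^ 3 * d - 27 * a ^ 2 * d ^ 2 + 18 * a * b * c * d

/-- The point `(s, t)` is a singular point of the curve
`a(s) t³ + b(s) t² + c(s) t + d(s) = 0`. -/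
structure IsCurveSing (a b c d : K[X]) (s t : K) : Prop where
  eval_eq : a.eval s * t ^ 3 + b.eval s * t ^ 2 + c.eval s * t + d.eval s = 0
  deriv_left : a.derivative.eval s * t ^ 3 + b.derivative.eval s * t ^ 2 +
    c.derivative.eval s * t + d.derivative.eval s = 0
  deriv_right : 3 * a.eval s * t ^ 2 + 2 * b.eval s * t + c.eval s = 0

/-- The determinant of the Hessian of `a(s) t³ + b(s) t² + c(s) t + d(s)`. -/
noncomputable def curveHess (a b c d : K[X]) (s t : K) : K :=
  (a.derivative.derivative.eval s * t ^ 3 + b.derivative.derivative.eval s * t ^ 2 +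
      c.derivative.derivative.eval s * t + d.derivative.derivative.eval s) *
    (6 * a.eval s * t + 2 * b.eval s) -
  (3 * a.derivative.eval s * t ^ 2 + 2 * b.derivative.eval s * t + c.derivative.eval s) ^ 2

/-- A double component that is the graph of the rational function `p / r` contains a singular point
with degenerate Hessian. -/
theorem exists_curveHess_eq_zero_of_double_root [CharZero K] {a b c d p r : K[X]} (hr : r ≠ 0)
    (h₁ : a * p ^ 3 + b * p ^ 2 * r + c * p * r ^ 2 + d * r ^ 3 = 0)
    (h₂ : 3 * a * p ^ 2 + 2 * b * p * r + c * r ^ 2 = 0) :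
    ∃ s t, IsCurveSing a b c d s t ∧ curveHess a b c d s t = 0 := by
  have h₃ : b * p ^ 2 + 2 * c * p * r + 3 * d * r ^ 2 = 0 := by
    refine (mul_eq_zero.1 ?_).resolve_left hr
    linear_combination 3 * h₁ - p * h₂
  have h₄ : derivative a * p ^ 3 + derivative b * p ^ 2 * r + derivative c * p * r ^ 2 +
      derivative d * r ^ 3 = 0 := by
    have := congrArg derivative h₁
    simp only [derivative_add, derivative_mul, derivative_pow, derivative_zero] at this
    simp only [Nat.cast_ofNat, C_ofNat] at this
    linear_combination this - derivative p * h₂ - derivative r * h₃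
  have h₅ := congrArg derivative h₂
  have h₆ := congrArg derivative h₄
  obtain ⟨s, hs⟩ : ∃ s, r.eval s ≠ 0 := by
    by_contra! h
    exact hr (Polynomial.funext (by simpa using h))
  simp only [derivative_add, derivative_mul, derivative_pow, derivative_zero] at h₅ h₆
  have e₁ := congrArg (eval s) h₁
  have e₂ := congrArg (eval s) h₂
  have e₄ := congrArg (eval s) h₄
  have e₅ := congrArg (eval s) h₅
  have e₆ := congrArg (eval s) h₆
  simp at e₁ e₂ e₄ e₅ e₆
  obtain ⟨t, ht⟩ : ∃ t, p.eval s = t * r.eval s := ⟨p.eval s / r.eval s, by field_simp⟩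
  rw [ht] at e₁ e₂ e₄ e₅ e₆
  have hG : IsCurveSing a b c d s t := by
    constructor
    · refine (mul_eq_zero.1 ?_).resolve_left (pow_ne_zero 3 hs)
      linear_combination e₁
    · refine (mul_eq_zero.1 ?_).resolve_left (pow_ne_zero 3 hs)
      linear_combination e₄
    · refine (mul_eq_zero.1 ?_).resolve_left (pow_ne_zero 2 hs)
      linear_combination e₂
  refine ⟨s, t, hG, ?_⟩
  obtain ⟨g₁, g₂, g₃⟩ := hG
  set P := p.derivative.eval s
  set R := r.derivative.eval s
  set ρ := r.eval s
  set Gss := a.derivative.derivative.eval s * t ^ 3 + b.derivative.derivative.eval s * t ^ 2 +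
      c.derivative.derivative.eval s * t + d.derivative.derivative.eval s with hss
  set Gtt := 6 * a.eval s * t + 2 * b.eval s with htt
  set Gst := 3 * a.derivative.eval s * t ^ 2 + 2 * b.derivative.eval s * t +
    c.derivative.eval s with hst
  have k₁ : ρ * Gst + (P - t * R) * Gtt = 0 := by
    refine (mul_eq_zero.1 ?_).resolve_left hs
    rw [htt, hst]
    linear_combination e₅ - 2 * R * ρ * g₃
  have k₂ : ρ * Gss + (P - t * R) * Gst = 0 := by
    refine (mul_eq_zero.1 ?_).resolve_left (pow_ne_zero 2 hs)
    rw [hss, hst]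
    linear_combination e₆ - 3 * ρ ^ 2 * R * g₂
  change Gss * Gtt - Gst ^ 2 = 0
  refine (mul_eq_zero.1 ?_).resolve_left hs
  linear_combination Gtt * k₂ - Gst * k₁

theorem cubicDiscr_ne_zero [CharZero K] {a b c d : K[X]} (ha : a ≠ 0)
    (h : ∀ s t, IsCurveSing a b c d s t → curveHess a b c d s t ≠ 0) :
    cubicDiscr a b c d ≠ 0 := by
  intro hD
  rw [cubicDiscr] at hD
  suffices ∃ p r : K[X], r ≠ 0 ∧ a * p ^ 3 + b * p ^ 2 * r + c * p * r ^ 2 + d * r ^ 3 = 0 ∧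
      3 * a * p ^ 2 + 2 * b * p * r + c * r ^ 2 = 0 by
    obtain ⟨p, r, hr, h₁, h₂⟩ := this
    obtain ⟨s, t, hst, h0⟩ := exists_curveHess_eq_zero_of_double_root hr h₁ h₂
    exact h s t hst h0
  by_cases he : b ^ 2 - 3 * a * c = 0
  · have h₁ : 2 * b ^ 3 - 9 * a * b * c + 27 * a ^ 2 * d = 0 := by
      refine pow_eq_zero_iff two_ne_zero |>.1 ?_
      linear_combination -27 * a ^ 2 * hD + 4 * (b ^ 2 - 3 * a * c) ^ 2 * he
    exact ⟨-b, 3 * a, mul_ne_zero (by norm_num) ha, by linear_combination a * h₁,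
      by linear_combination -3 * a * he⟩
  · refine ⟨9 * a * d - b * c, 2 * (b ^ 2 - 3 * a * c), mul_ne_zero (by norm_num) he, ?_, ?_⟩
    · linear_combination (-27 * a ^ 2 * d + 9 * a * b * c - 2 * b ^ 3) * hD
    · linear_combination (-9 * a) * hD

theorem sq_dvd_cubicDiscr {a b c d : K[X]} {s t : K} (h : IsCurveSing a b c d s t) :
    (Polynomial.X - Polynomial.C s) ^ 2 ∣ cubicDiscr a b c d := by
  obtain ⟨g₁, g₂, g₃⟩ := h
  set x : K[X] := Polynomial.X - Polynomial.C s
  set y : K[X] := Polynomial.C t with hy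
  obtain ⟨w, hw⟩ : x ∣ 3 * a * y ^ 2 + 2 * b * y + c := by
    rw [dvd_iff_isRoot]
    simpa [IsRoot, hy] using g₃
  obtain ⟨u, hu⟩ : x ∣ a * y ^ 3 + b * y ^ 2 + c * y + d := by
    rw [dvd_iff_isRoot]
    simpa [IsRoot, hy] using g₁
  obtain ⟨u', rfl⟩ : x ∣ u := by
    rw [dvd_iff_isRoot]
    have := congrArg (eval s) (congrArg derivative hu)
    simp only [derivative_add, derivative_mul, derivative_pow] at this
    simp [x, hy] at this
    rw [IsRoot, ← this]
    exact g₂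
  have : cubicDiscr a b c d = cubicDiscr a (b + 3 * a * y) (3 * a * y ^ 2 + 2 * b * y + c)
      (a * y ^ 3 + b * y ^ 2 + c * y + d) := by
    simp only [cubicDiscr]
    ring
  rw [this, hw, hu, cubicDiscr]
  refine ⟨(b + 3 * a * y) ^ 2 * w ^ 2 - 4 * a * x * w ^ 3 - 4 * (b + 3 * a * y) ^ 3 * u' -
    27 * a ^ 2 * x ^ 2 * u' ^ 2 + 18 * a * (b + 3 * a * y) * x * w * u', ?_⟩
  ring

theorem pow_four_dvd_cubicDiscr {R : Type*} [CommRing R] {a b c d x : R} (ha : x ∣ a)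
    (hb : x ∣ b) (hc : x ∣ c) (hd : x ∣ d) : x ^ 4 ∣ cubicDiscr a b c d := by
  obtain ⟨a, rfl⟩ := ha
  obtain ⟨b, rfl⟩ := hb
  obtain ⟨c, rfl⟩ := hc
  obtain ⟨d, rfl⟩ := hd
  exact ⟨cubicDiscr a b c d, by simp only [cubicDiscr]; ring⟩

theorem natDegree_cubicDiscr_le {a b c d : K[X]} (ha : a.natDegree ≤ 3) (hb : b.natDegree ≤ 3)
    (hc : c.natDegree ≤ 3) (hd : d.natDegree ≤ 3) : (cubicDiscr a b c d).natDegree ≤ 12 := by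
  rw [cubicDiscr]
  compute_degree
  all_goals omega

/-- A nonzero binary cubic has at most one double root. -/
theorem eq_of_double_roots [CharZero K] {a b c d t u : K}
    (h : ¬ (a = 0 ∧ b = 0 ∧ c = 0 ∧ d = 0))
    (ht : a * t ^ 3 + b * t ^ 2 + c * t + d = 0) (ht' : 3 * a * t ^ 2 + 2 * b * t + c = 0)
    (hu : a * u ^ 3 + b * u ^ 2 + c * u + d = 0) (hu' : 3 * a * u ^ 2 + 2 * b * u + c = 0) :
    t = u := by
  by_contra hne
  have hne : t - u ≠ 0 := sub_ne_zero.2 hne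
  have ha : a = 0 := by
    refine (mul_eq_zero.1 ?_).resolve_left (pow_ne_zero 3 hne)
    linear_combination (t - u) * (ht' + hu') - 2 * (ht - hu)
  have hb : b = 0 := by
    subst ha
    refine (mul_eq_zero.1 ?_).resolve_left (mul_ne_zero two_ne_zero hne)
    linear_combination ht' - hu'
  have hc : c = 0 := by
    subst ha hb
    linear_combination ht'
  refine h ⟨ha, hb, hc, ?_⟩
  subst ha hb hc
  linear_combination ht

/-- The number of roots of a nonzero binary cubic is at most three. -/
theorem card_le_three_of_cubic_roots {a b c d : K} (h : ¬ (a = 0 ∧ b = 0 ∧ c = 0 ∧ d = 0))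
    (S : Finset K) (hS : ∀ t ∈ S, a * t ^ 3 + b * t ^ 2 + c * t + d = 0) : S.card ≤ 3 := by
  classical
  set P : K[X] := (⟨a, b, c, d⟩ : Cubic K).toPoly with hP
  have hP0 : P ≠ 0 := by
    intro h0
    rw [hP, Cubic.toPoly_eq_zero_iff, Cubic.ext_iff] at h0
    exact h h0
  calc S.card ≤ P.roots.toFinset.card := by
        refine Finset.card_le_card fun t ht => ?_
        rw [Multiset.mem_toFinset, mem_roots hP0]
        simpa [IsRoot, hP, Cubic.toPoly] using hS t ht
    _ ≤ P.roots.card := Multiset.toFinset_card_le _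
    _ ≤ P.natDegree := card_roots' _
    _ ≤ 3 := by rw [hP, Cubic.toPoly]; compute_degree

open scoped Classical in
theorem card_fiber_le [CharZero K] {a b c d : K[X]} (ha : a ≠ 0)
    (h : ∀ s t, IsCurveSing a b c d s t → curveHess a b c d s t ≠ 0) (s : K) (F : Finset K)
    (hF : ∀ t ∈ F, IsCurveSing a b c d s t) (hne : F.Nonempty) :
    2 * F.card ≤ (cubicDiscr a b c d).rootMultiplicity s + if a.IsRoot s then 2 else 0 := by
  have hD := cubicDiscr_ne_zero ha h
  by_cases hv : a.eval s = 0 ∧ b.eval s = 0 ∧ c.eval s = 0 ∧ d.eval s = 0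
  · obtain ⟨va, vb, vc, vd⟩ := hv
    have h4 : 4 ≤ (cubicDiscr a b c d).rootMultiplicity s :=
      (le_rootMultiplicity_iff hD).2 (pow_four_dvd_cubicDiscr (dvd_iff_isRoot.2 va)
        (dvd_iff_isRoot.2 vb) (dvd_iff_isRoot.2 vc) (dvd_iff_isRoot.2 vd))
    have h3 : F.card ≤ 3 := by
      refine card_le_three_of_cubic_roots (a := a.derivative.eval s) (b := b.derivative.eval s)
        (c := c.derivative.eval s) (d := d.derivative.eval s) ?_ F fun t ht => (hF t ht).deriv_left
      rintro ⟨wa, wb, wc, wd⟩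
      obtain ⟨t, ht⟩ := hne
      refine h s t (hF t ht) ?_
      simp [curveHess, va, vb, wa, wb, wc]
    rw [if_pos (show a.IsRoot s from va)]
    omega
  · have h1 : F.card ≤ 1 := Finset.card_le_one.2 fun t ht u hu =>
      eq_of_double_roots hv (hF t ht).eval_eq (hF t ht).deriv_right (hF u hu).eval_eq
        (hF u hu).deriv_right
    obtain ⟨t, ht⟩ := hne
    have h2 : 2 ≤ (cubicDiscr a b c d).rootMultiplicity s :=
      (le_rootMultiplicity_iff hD).2 (sq_dvd_cubicDiscr (hF t ht))
    omega

/-- A bicubic curve all of whose singular points are nodes has at most nine of them. -/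
theorem card_curveSing_le_nine [CharZero K] {a b c d : K[X]} (ha : a.natDegree ≤ 3)
    (hb : b.natDegree ≤ 3) (hc : c.natDegree ≤ 3) (hd : d.natDegree ≤ 3) (ha0 : a ≠ 0)
    (h : ∀ s t, IsCurveSing a b c d s t → curveHess a b c d s t ≠ 0) (S : Finset (K × K))
    (hS : ∀ x ∈ S, IsCurveSing a b c d x.1 x.2) : S.card ≤ 9 := by
  classical
  have hD := cubicDiscr_ne_zero ha0 h
  set D := cubicDiscr a b c d with hDdef
  set I := S.image Prod.fst
  have key : ∀ s ∈ I, 2 * (S.filter fun x => x.1 = s).card ≤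
      D.rootMultiplicity s + if a.IsRoot s then 2 else 0 := by
    intro s hs
    obtain ⟨x, hx, rfl⟩ := Finset.mem_image.1 hs
    have hinj : Set.InjOn Prod.snd (S.filter fun y => y.1 = x.1 : Set (K × K)) := by
      intro y hy z hz hyz
      simp only [Finset.coe_filter, Set.mem_ofPred_eq] at hy hz
      exact Prod.ext (hy.2.trans hz.2.symm) hyz
    rw [← Finset.card_image_of_injOn hinj]
    refine card_fiber_le ha0 h x.1 _ ?_ ⟨x.2, Finset.mem_image_of_mem _ (by simp [hx])⟩
    intro t ht
    obtain ⟨y, hy, rfl⟩ := Finset.mem_image.1 ht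
    rw [Finset.mem_filter] at hy
    exact hy.2 ▸ hS y hy.1
  have h12 : ∑ s ∈ I, D.rootMultiplicity s ≤ 12 := by
    calc ∑ s ∈ I, D.rootMultiplicity s = ∑ s ∈ I, D.roots.count s := by simp only [count_roots]
      _ ≤ D.roots.card := by
          rw [← Multiset.toFinset_sum_count_eq, ← Finset.sum_filter_ne_zero]
          refine Finset.sum_le_sum_of_subset fun s hs => ?_
          simpa [Multiset.count_ne_zero, and_comm] using (Finset.mem_filter.1 hs).2
      _ ≤ D.natDegree := card_roots' _
      _ ≤ 12 := natDegree_cubicDiscr_le ha hb hc hd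
  have h6 : ∑ s ∈ I, (if a.IsRoot s then 2 else 0) ≤ 6 := by
    rw [← Finset.sum_filter, Finset.sum_const, smul_eq_mul]
    refine Nat.mul_le_mul_right 2 (?_ : _ ≤ 3)
    calc _ ≤ a.roots.toFinset.card := by
          refine Finset.card_le_card fun s hs => ?_
          rw [Multiset.mem_toFinset, mem_roots ha0]
          exact (Finset.mem_filter.1 hs).2
      _ ≤ a.roots.card := Multiset.toFinset_card_le _
      _ ≤ a.natDegree := card_roots' _
      _ ≤ 3 := ha
  have hsum : S.card = ∑ s ∈ I, (S.filter fun x => x.1 = s).card :=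
    Finset.card_eq_sum_card_fiberwise fun x hx => Finset.mem_image_of_mem _ hx
  have := Finset.sum_le_sum key
  rw [← Finset.mul_sum, ← hsum, Finset.sum_add_distrib] at this
  omega

theorem exists_evalEval_ne_zero [Infinite K] {P : K[X][X]} (hP : P ≠ 0) :
    ∃ s t, P.evalEval s t ≠ 0 := by
  obtain ⟨n, hn⟩ : ∃ n, P.coeff n ≠ 0 := by
    by_contra! h
    exact hP (Polynomial.ext (by simpa using h))
  obtain ⟨s, hs⟩ : ∃ s, (P.coeff n).eval s ≠ 0 := by
    by_contra! h
    exact hn (Polynomial.funext (by simpa using h))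
  have hmap : P.map (evalRingHom s) ≠ 0 := fun h0 => hs (by
    simpa using congrArg (fun p => Polynomial.coeff p n) h0)
  obtain ⟨t, ht⟩ : ∃ t, (P.map (evalRingHom s)).eval t ≠ 0 := by
    by_contra! h
    exact hmap (Polynomial.funext (by simpa using h))
  exact ⟨s, t, by rwa [map_evalRingHom_eval] at ht⟩

end BicubicCurves

section SymmetricTrilinearForms

variable {K V : Type*} [Field K] [AddCommGroup V] [Module K V]

/-- A symmetric trilinear form whose associated cubic hypersurface has at worst nodes. -/
structure IsNodalCubic (T : V →ₗ[K] V →ₗ[K] V →ₗ[K] K) : Prop where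
  swap_left : ∀ x y z, T x y z = T y x z
  swap_right : ∀ x y z, T x y z = T x z y
  nodal : ∀ v, v ≠ 0 → (∀ w, T v v w = 0) → ∀ x, (∀ w, T v x w = 0) → ∃ c : K, x = c • v

/-- A singular point `p` of the cubic, together with vectors that are a hyperbolic basis of a
complement of `p` for the quadratic form of the tangent cone at `p`. -/
structure IsFrame (T : V →ₗ[K] V →ₗ[K] V →ₗ[K] K) (p e₁ e₂ e₃ e₄ : V) : Prop where
  ne_zero : p ≠ 0
  sing : ∀ w, T p p w = 0
  q₁₁ : T p e₁ e₁ = 0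
  q₁₂ : T p e₁ e₂ = 0
  q₁₃ : T p e₁ e₃ = 0
  q₁₄ : T p e₁ e₄ = 1
  q₂₂ : T p e₂ e₂ = 0
  q₂₃ : T p e₂ e₃ = -1
  q₂₄ : T p e₂ e₄ = 0
  q₃₃ : T p e₃ e₃ = 0
  q₃₄ : T p e₃ e₄ = 0
  q₄₄ : T p e₄ e₄ = 0

variable {T : V →ₗ[K] V →ₗ[K] V →ₗ[K] K} {p e₁ e₂ e₃ e₄ : V}

namespace IsFrame

theorem q₂₁ (h : IsFrame T p e₁ e₂ e₃ e₄) (hT : IsNodalCubic T) : T p e₂ e₁ = 0 := by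
  rw [hT.swap_right, h.q₁₂]

theorem q₃₁ (h : IsFrame T p e₁ e₂ e₃ e₄) (hT : IsNodalCubic T) : T p e₃ e₁ = 0 := by
  rw [hT.swap_right, h.q₁₃]

theorem q₄₁ (h : IsFrame T p e₁ e₂ e₃ e₄) (hT : IsNodalCubic T) : T p e₄ e₁ = 1 := by
  rw [hT.swap_right, h.q₁₄]

theorem q₃₂ (h : IsFrame T p e₁ e₂ e₃ e₄) (hT : IsNodalCubic T) : T p e₃ e₂ = -1 := by
  rw [hT.swap_right, h.q₂₃]

theorem q₄₂ (h : IsFrame T p e₁ e₂ e₃ e₄) (hT : IsNodalCubic T) : T p e₄ e₂ = 0 := by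
  rw [hT.swap_right, h.q₂₄]

theorem q₄₃ (h : IsFrame T p e₁ e₂ e₃ e₄) (hT : IsNodalCubic T) : T p e₄ e₃ = 0 := by
  rw [hT.swap_right, h.q₃₄]

theorem exists_eq (h : IsFrame T p e₁ e₂ e₃ e₄) (hT : IsNodalCubic T)
    (hV : Module.finrank K V = 5) (x : V) :
    ∃ c : K, x = c • p + T p x e₄ • e₁ - T p x e₃ • e₂ - T p x e₂ • e₃ + T p x e₁ • e₄ := by
  have hli : LinearIndependent K ![p, e₁, e₂, e₃, e₄] := by
    rw [Fintype.linearIndependent_iff]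
    intro g hg
    simp only [Fin.sum_univ_five, Matrix.cons_val] at hg
    have key (w : V) := congrArg (fun x => T p x w) hg
    simp only [map_add, map_smul, LinearMap.add_apply, LinearMap.smul_apply, smul_eq_mul,
      h.sing, map_zero, LinearMap.zero_apply] at key
    have k₁ := key e₁
    have k₂ := key e₂
    have k₃ := key e₃
    have k₄ := key e₄
    simp [h.q₁₁, h.q₁₂, h.q₁₃, h.q₁₄, h.q₂₂, h.q₂₃, h.q₂₄, h.q₃₃, h.q₃₄, h.q₄₄, h.q₂₁ hT, h.q₃₁ hT,
      h.q₄₁ hT, h.q₃₂ hT, h.q₄₂ hT, h.q₄₃ hT] at k₁ k₂ k₃ k₄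
    simp [k₁, k₂, k₃, k₄, h.ne_zero] at hg
    intro i
    fin_cases i <;> assumption
  have hmem : x ∈ Submodule.span K (Set.range ![p, e₁, e₂, e₃, e₄]) := by
    rw [hli.span_eq_top_of_card_eq_finrank (by simp [hV])]
    trivial
  obtain ⟨g, rfl⟩ := (Submodule.mem_span_range_iff_exists_fun K).1 hmem
  refine ⟨g 0, ?_⟩
  simp only [Fin.sum_univ_five, Matrix.cons_val, map_add, map_smul, LinearMap.add_apply,
    LinearMap.smul_apply, smul_eq_mul, h.sing, h.q₁₁, h.q₁₂, h.q₁₃, h.q₁₄, h.q₂₂, h.q₂₃, h.q₂₄,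
    h.q₃₃, h.q₃₄, h.q₄₄, h.q₂₁ hT, h.q₃₁ hT, h.q₄₁ hT, h.q₃₂ hT, h.q₄₂ hT, h.q₄₃ hT]
  module

theorem eq_zero_of_apply (h : IsFrame T p e₁ e₂ e₃ e₄) (hT : IsNodalCubic T)
    (hV : Module.finrank K V = 5) (L : V →ₗ[K] K) (h₀ : L p = 0) (h₁ : L e₁ = 0) (h₂ : L e₂ = 0)
    (h₃ : L e₃ = 0) (h₄ : L e₄ = 0) (x : V) : L x = 0 := by
  obtain ⟨c, hc⟩ := h.exists_eq hT hV x
  rw [hc]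
  simp [h₀, h₁, h₂, h₃, h₄]

/-- The frame adapted to the point `e₁ + s e₂ + t e₃ + s t e₄` of the tangent cone. -/
theorem translate (h : IsFrame T p e₁ e₂ e₃ e₄) (hT : IsNodalCubic T) (s t : K) :
    IsFrame T p (e₁ + s • e₂ + t • e₃ + (s * t) • e₄) (e₂ + t • e₄) (e₃ + s • e₄) e₄ := by
  constructor
  · exact h.ne_zero
  · exact h.sing
  all_goals
    simp only [map_add, map_smul, LinearMap.add_apply,
      LinearMap.smul_apply, smul_eq_mul, h.q₁₁, h.q₁₂, h.q₁₃, h.q₁₄, h.q₂₂, h.q₂₃, h.q₂₄,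
      h.q₃₃, h.q₃₄, h.q₄₄, h.q₂₁ hT, h.q₃₁ hT, h.q₄₁ hT, h.q₃₂ hT, h.q₄₂ hT, h.q₄₃ hT]
    try ring

theorem flip (h : IsFrame T p e₁ e₂ e₃ e₄) (hT : IsNodalCubic T) :
    IsFrame T p e₄ (-e₃) (-e₂) e₁ := by
  constructor
  · exact h.ne_zero
  · exact h.sing
  all_goals simp [h.q₁₁, h.q₂₂, h.q₃₃, h.q₄₄, h.q₂₁ hT, h.q₃₁ hT, h.q₄₁ hT, h.q₃₂ hT, h.q₄₂ hT,
    h.q₄₃ hT]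

/-- At a singular point of the cubic other than `p`, the branch curve has nondegenerate Hessian. -/
theorem hess_ne_zero [CharZero K] (h : IsFrame T p e₁ e₂ e₃ e₄) (hT : IsNodalCubic T)
    (hV : Module.finrank K V = 5) (h₁ : T e₁ e₁ e₁ = 0) (h₂ : T e₁ e₁ e₂ = 0)
    (h₃ : T e₁ e₁ e₃ = 0) :
    4 * (T e₁ e₂ e₂ * T e₁ e₃ e₃) - (2 * T e₁ e₂ e₃ + T e₁ e₁ e₄) ^ 2 ≠ 0 := by
  intro hH
  obtain ⟨α, β, hαβ, k₁, k₂⟩ : ∃ α β : K, ¬ (α = 0 ∧ β = 0) ∧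
      2 * T e₁ e₂ e₂ * α + (2 * T e₁ e₂ e₃ + T e₁ e₁ e₄) * β = 0 ∧
      (2 * T e₁ e₂ e₃ + T e₁ e₁ e₄) * α + 2 * T e₁ e₃ e₃ * β = 0 := by
    by_cases h0 : 2 * T e₁ e₃ e₃ = 0 ∧ 2 * T e₁ e₂ e₃ + T e₁ e₁ e₄ = 0
    · exact ⟨0, 1, by simp, by simp [h0.2], by simp [h0.1]⟩
    · refine ⟨2 * T e₁ e₃ e₃, -(2 * T e₁ e₂ e₃ + T e₁ e₁ e₄), ?_, ?_, ?_⟩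
      · rintro ⟨u, v⟩
        exact h0 ⟨u, neg_eq_zero.1 v⟩
      · linear_combination hH
      · ring
  have e₁₁ (z : V) : T e₁ p z = T p e₁ z := hT.swap_left _ _ _
  have r₁ (x y : V) : T x y p = T p x y := by rw [hT.swap_right, hT.swap_left]
  set v : V := (-T e₁ e₁ e₄ / 2) • p + e₁ with hv
  set x : V := (-(α * T e₁ e₂ e₄ + β * T e₁ e₃ e₄)) • p + (α • e₂ + β • e₃) with hx
  have q₁v : T p v e₄ = 1 := by simp [hv, h.sing, h.q₁₄]
  have s₂ : T e₁ e₂ e₁ = 0 := by rw [hT.swap_right, h₂]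
  have s₃ : T e₁ e₃ e₁ = 0 := by rw [hT.swap_right, h₃]
  have s₃₂ : T e₁ e₃ e₂ = T e₁ e₂ e₃ := hT.swap_right _ _ _
  have hsing : ∀ w, T v v w = 0 := by
    apply h.eq_zero_of_apply hT hV (T v v)
    all_goals
      simp only [hv, map_add, map_smul, LinearMap.add_apply, LinearMap.smul_apply, smul_eq_mul,
        h.sing, e₁₁, r₁, h.q₁₁, h.q₁₂, h.q₁₃, h.q₁₄, h₁, h₂, h₃]
      ring1
  have hker : ∀ w, T v x w = 0 := by
    apply h.eq_zero_of_apply hT hV (T v x)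
    all_goals
      simp only [hv, hx, map_add, map_smul, LinearMap.add_apply, LinearMap.smul_apply,
        smul_eq_mul, h.sing, e₁₁, r₁, h.q₁₁, h.q₁₂, h.q₁₃, h.q₁₄, h.q₂₂, h.q₂₃, h.q₂₄, h.q₃₃,
        h.q₃₄, h.q₂₁ hT, h.q₃₁ hT, h.q₃₂ hT, s₂, s₃, s₃₂]
    · ring1
    · ring1
    · linear_combination k₁ / 2
    · linear_combination k₂ / 2
    · ring1
  obtain ⟨c, hc⟩ := hT.nodal v (by rintro h0; simp [h0] at q₁v) hsing x hker
  have hc0 : c = 0 := by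
    have := congrArg (fun y => T p y e₄) hc
    simpa [hx, hv, h.sing, h.q₁₄, h.q₂₄, h.q₃₄] using this.symm
  rw [hc0, zero_smul] at hc
  refine hαβ ⟨?_, ?_⟩
  · have := congrArg (fun y => T p y e₃) hc
    simpa [hx, h.sing, h.q₂₃, h.q₃₃] using this
  · have := congrArg (fun y => T p y e₂) hc
    simpa [hx, h.sing, h.q₂₂, h.q₃₂ hT] using this

end IsFrame

set_option maxHeartbeats 2000000 in
theorem exists_curve [CharZero K] (hT : IsNodalCubic T) (e₁ e₂ e₃ e₄ : V) :
    ∃ a b c d : Polynomial K, a.natDegree ≤ 3 ∧ b.natDegree ≤ 3 ∧ c.natDegree ≤ 3 ∧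
      d.natDegree ≤ 3 ∧ a.coeff 3 = T e₄ e₄ e₄ ∧ ∀ (s t : K) (φ : V),
      φ = e₁ + s • e₂ + t • e₃ + (s * t) • e₄ →
      (a.eval s * t ^ 3 + b.eval s * t ^ 2 + c.eval s * t + d.eval s = T φ φ φ) ∧
      (IsCurveSing a b c d s t ↔
        T φ φ φ = 0 ∧ T φ φ (e₂ + t • e₄) = 0 ∧ T φ φ (e₃ + s • e₄) = 0) ∧
      curveHess a b c d s t = 9 * (4 * (T φ (e₂ + t • e₄) (e₂ + t • e₄) *
        T φ (e₃ + s • e₄) (e₃ + s • e₄)) -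
        (2 * T φ (e₂ + t • e₄) (e₃ + s • e₄) + T φ φ e₄) ^ 2) := by
  have h₁ := hT.swap_left
  have h₂ := hT.swap_right
  refine ⟨.C (T e₃ e₃ e₃) + .C (3 * T e₃ e₃ e₄) * .X + .C (3 * T e₃ e₄ e₄) * .X ^ 2 +
      .C (T e₄ e₄ e₄) * .X ^ 3,
    .C (3 * T e₁ e₃ e₃) + .C (3 * (2 * T e₁ e₃ e₄ + T e₂ e₃ e₃)) * .X +
      .C (3 * (T e₁ e₄ e₄ + 2 * T e₂ e₃ e₄)) * .X ^ 2 + .C (3 * T e₂ e₄ e₄) * .X ^ 3,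
    .C (3 * T e₁ e₁ e₃) + .C (3 * (T e₁ e₁ e₄ + 2 * T e₁ e₂ e₃)) * .X +
      .C (3 * (2 * T e₁ e₂ e₄ + T e₂ e₂ e₃)) * .X ^ 2 + .C (3 * T e₂ e₂ e₄) * .X ^ 3,
    .C (T e₁ e₁ e₁) + .C (3 * T e₁ e₁ e₂) * .X + .C (3 * T e₁ e₂ e₂) * .X ^ 2 +
      .C (T e₂ e₂ e₂) * .X ^ 3, ?_, ?_, ?_, ?_, ?_, ?_⟩
  · compute_degree
  · compute_degree
  · compute_degree
  · compute_degree
  · compute_degree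
    all_goals norm_num
  rintro s t φ rfl
  refine ⟨?_, ?_, ?_⟩
  · simp only [map_add, map_smul, LinearMap.add_apply, LinearMap.smul_apply, smul_eq_mul]
    simp only [h₁, h₂]
    simp
    ring1
  · constructor
    · rintro ⟨g₁, g₂, g₃⟩
      simp at g₁ g₂ g₃
      simp only [map_add, map_smul, LinearMap.add_apply, LinearMap.smul_apply, smul_eq_mul]
      simp only [h₁, h₂]
      refine ⟨?_, ?_, ?_⟩
      · linear_combination g₁
      · linear_combination g₂ / 3
      · linear_combination g₃ / 3
    · simp only [map_add, map_smul, LinearMap.add_apply, LinearMap.smul_apply, smul_eq_mul]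
      simp only [h₁, h₂]
      rintro ⟨g₁, g₂, g₃⟩
      constructor
      · simp
        linear_combination g₁
      · simp
        linear_combination 3 * g₂
      · simp
        linear_combination 3 * g₃
  · simp only [map_add, map_smul, LinearMap.add_apply, LinearMap.smul_apply, smul_eq_mul]
    simp only [h₁, h₂]
    simp [curveHess]
    ring1

end SymmetricTrilinearForms

section CountingNodes

variable {K V : Type*} [Field K] [AddCommGroup V] [Module K V]
variable {T : V →ₗ[K] V →ₗ[K] V →ₗ[K] K} {p e₁ e₂ e₃ e₄ : V}

namespace IsFrame

theorem curveHess_ne_zero [CharZero K] (h : IsFrame T p e₁ e₂ e₃ e₄) (hT : IsNodalCubic T)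
    (hV : Module.finrank K V = 5) {a b c d : Polynomial K}
    (hcurve : ∀ (s t : K) (φ : V), φ = e₁ + s • e₂ + t • e₃ + (s * t) • e₄ →
      (a.eval s * t ^ 3 + b.eval s * t ^ 2 + c.eval s * t + d.eval s = T φ φ φ) ∧
      (IsCurveSing a b c d s t ↔
        T φ φ φ = 0 ∧ T φ φ (e₂ + t • e₄) = 0 ∧ T φ φ (e₃ + s • e₄) = 0) ∧
      curveHess a b c d s t = 9 * (4 * (T φ (e₂ + t • e₄) (e₂ + t • e₄) *
        T φ (e₃ + s • e₄) (e₃ + s • e₄)) -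
        (2 * T φ (e₂ + t • e₄) (e₃ + s • e₄) + T φ φ e₄) ^ 2))
    (s t : K) (hst : IsCurveSing a b c d s t) : curveHess a b c d s t ≠ 0 := by
  obtain ⟨-, h₂, h₃⟩ := hcurve s t _ rfl
  obtain ⟨g₁, g₂, g₃⟩ := h₂.1 hst
  rw [h₃]
  exact mul_ne_zero (by norm_num) ((h.translate hT s t).hess_ne_zero hT hV g₁ g₂ g₃)

/-- A node in general position with respect to a frame is determined by a point of the tangent
cone. -/
theorem exists_eq_smul [CharZero K] (h : IsFrame T p e₁ e₂ e₃ e₄) (hT : IsNodalCubic T)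
    (hV : Module.finrank K V = 5) {x : V} (hx : ∀ w, T x x w = 0) (hx₄ : T p x e₄ ≠ 0) {s t : K}
    (hs : s = -T p x e₃ / T p x e₄) (ht : t = -T p x e₂ / T p x e₄) {φ : V}
    (hφ : φ = e₁ + s • e₂ + t • e₃ + (s * t) • e₄) :
    x = T p x e₄ • ((-T φ φ e₄ / 2) • p + φ) ∧
      T φ φ φ = 0 ∧ T φ φ (e₂ + t • e₄) = 0 ∧ T φ φ (e₃ + s • e₄) = 0 := by
  obtain ⟨c, hc⟩ := h.exists_eq hT hV x
  set y := T p x e₄ with hy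
  have hs' : T p x e₃ = -(y * s) := by rw [hs]; field_simp
  have ht' : T p x e₂ = -(y * t) := by rw [ht]; field_simp
  have hq : T p x x = 0 := by rw [hT.swap_left, hT.swap_right, hx]
  have h₁ : T p x e₁ = y * (s * t) := by
    rw [hs', ht'] at hc
    have hq' := hq
    nth_rewrite 2 [hc] at hq'
    have hpp : T p x p = 0 := by rw [hT.swap_right, h.sing]
    simp only [map_add, map_sub, map_smul, smul_eq_mul, hpp, hs', ht', ← hy] at hq'
    refine mul_left_cancel₀ (mul_ne_zero two_ne_zero hx₄) ?_
    linear_combination hq'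
  obtain ⟨τ, hτ⟩ : ∃ τ : K, x = y • (τ • p + φ) := by
    refine ⟨c / y, ?_⟩
    have : y • (c / y) • p = c • p := by rw [smul_smul, mul_div_cancel₀ _ hx₄]
    rw [smul_add, this, hφ]
    nth_rewrite 1 [hc]
    rw [hs', ht', h₁]
    module
  have F := h.translate hT s t
  rw [← hφ] at F
  have key (w : V) : 2 * τ * T p φ w + T φ φ w = 0 := by
    have := hx w
    rw [hτ] at this
    simp only [map_add, map_smul, LinearMap.add_apply, LinearMap.smul_apply, smul_eq_mul,
      h.sing, hT.swap_left φ p] at this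
    refine (mul_eq_zero.1 ?_).resolve_left (mul_ne_zero hx₄ hx₄)
    linear_combination this
  have k₁ := key φ
  have k₂ := key (e₂ + t • e₄)
  have k₃ := key (e₃ + s • e₄)
  have k₄ := key e₄
  rw [F.q₁₁] at k₁
  rw [F.q₁₂] at k₂
  rw [F.q₁₃] at k₃
  rw [F.q₁₄] at k₄
  refine ⟨?_, by linear_combination k₁, by linear_combination k₂, by linear_combination k₃⟩
  have : τ = -T φ φ e₄ / 2 := by linear_combination k₄ / 2
  rw [← this]
  exact hτ

/-- The bound on the nodes other than `p`, for a frame in general position. -/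
theorem card_le_nine [CharZero K] (h : IsFrame T p e₁ e₂ e₃ e₄) (hT : IsNodalCubic T)
    (hV : Module.finrank K V = 5) (h₄ : T e₄ e₄ e₄ ≠ 0) (S : Finset (ℙ K V))
    (hS : ∀ x ∈ S, (∀ w, T x.rep x.rep w = 0) ∧ T p x.rep e₄ ≠ 0) : S.card ≤ 9 := by
  classical
  obtain ⟨a, b, c, d, ha, hb, hc, hd, ha₃, hcurve⟩ := exists_curve hT e₁ e₂ e₃ e₄
  set F : ℙ K V → K × K := fun x =>
    (-T p x.rep e₃ / T p x.rep e₄, -T p x.rep e₂ / T p x.rep e₄)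
  have hF (x : ℙ K V) (hx : x ∈ S) :=
    h.exists_eq_smul hT hV (hS x hx).1 (hS x hx).2 (s := (F x).1) (t := (F x).2) rfl rfl rfl
  have hinj : Set.InjOn F S := by
    intro x hx y hy hxy
    have hx' := (hF x hx).1
    have hy' := (hF y hy).1
    rw [← hxy] at hy'
    generalize (-T (e₁ + (F x).1 • e₂ + (F x).2 • e₃ + ((F x).1 * (F x).2) • e₄)
      (e₁ + (F x).1 • e₂ + (F x).2 • e₃ + ((F x).1 * (F x).2) • e₄) e₄ / 2) • p +
      (e₁ + (F x).1 • e₂ + (F x).2 • e₃ + ((F x).1 * (F x).2) • e₄) = z at hx' hy'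
    rw [← x.mk_rep, ← y.mk_rep, Projectivization.mk_eq_mk_iff']
    refine ⟨T p x.rep e₄ / T p y.rep e₄, ?_⟩
    nth_rewrite 2 [hy']
    rw [smul_smul, div_mul_cancel₀ _ (hS y hy).2, ← hx']
  rw [← Finset.card_image_of_injOn hinj]
  refine card_curveSing_le_nine ha hb hc hd ?_ (h.curveHess_ne_zero hT hV hcurve) _ ?_
  · rintro rfl
    exact h₄ (by simpa using ha₃.symm)
  · intro z hz
    obtain ⟨x, hx, rfl⟩ := Finset.mem_image.1 hz
    exact (hcurve _ _ _ rfl).2.1.2 (hF x hx).2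

open Polynomial in
/-- Some point of the tangent cone lies neither on the cubic nor on finitely many hyperplanes. -/
theorem exists_general_point [CharZero K] (h : IsFrame T p e₁ e₂ e₃ e₄) (hT : IsNodalCubic T)
    (hV : Module.finrank K V = 5) (S : Finset V) (hS : ∀ x ∈ S, ∃ w, T p x w ≠ 0) :
    ∃ s t : K, ∃ φ : V, φ = e₁ + s • e₂ + t • e₃ + (s * t) • e₄ ∧ T φ φ φ ≠ 0 ∧
      ∀ x ∈ S, T p x φ ≠ 0 := by
  obtain ⟨a, b, c, d, -, -, -, -, -, hcurve⟩ := exists_curve hT e₁ e₂ e₃ e₄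
  set P : K[X][X] := .C a * .X ^ 3 + .C b * .X ^ 2 + .C c * .X + .C d with hP
  set L : V → K[X][X] := fun x => .C (.C (T p x e₃) + .C (T p x e₄) * .X) * .X +
    .C (.C (T p x e₁) + .C (T p x e₂) * .X) with hL
  have hP0 : P ≠ 0 := by
    intro h0
    have h3 := congrArg (fun q => Polynomial.coeff q 3) h0
    have h2 := congrArg (fun q => Polynomial.coeff q 2) h0
    have h1 := congrArg (fun q => Polynomial.coeff q 1) h0
    have h4 := congrArg (fun q => Polynomial.coeff q 0) h0
    simp [hP, Polynomial.coeff_X, Polynomial.coeff_C] at h3 h2 h1 h4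
    clear_value P
    subst h3 h2 h1 h4
    refine h.curveHess_ne_zero hT hV hcurve 0 0 ⟨?_, ?_, ?_⟩ ?_ <;> simp [curveHess]
  have hL0 (x : V) (hx : x ∈ S) : L x ≠ 0 := by
    intro h0
    have h1 := congrArg (fun q => Polynomial.coeff q 1) h0
    have h0 := congrArg (fun q => Polynomial.coeff q 0) h0
    simp [hL] at h1 h0
    have h10 := congrArg (fun q => Polynomial.coeff q 0) h1
    have h11 := congrArg (fun q => Polynomial.coeff q 1) h1
    have h00 := congrArg (fun q => Polynomial.coeff q 0) h0
    have h01 := congrArg (fun q => Polynomial.coeff q 1) h0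
    simp [Polynomial.coeff_C] at h10 h11 h00 h01
    obtain ⟨w, hw⟩ := hS x hx
    refine hw (h.eq_zero_of_apply hT hV (T p x) ?_ h00 h01 h10 h11 w)
    rw [hT.swap_right, h.sing]
  obtain ⟨s, t, hst⟩ := exists_evalEval_ne_zero
    (mul_ne_zero hP0 (Finset.prod_ne_zero_iff.2 hL0))
  rw [evalEval_mul, evalEval_prod, mul_ne_zero_iff, Finset.prod_ne_zero_iff] at hst
  refine ⟨s, t, _, rfl, ?_, fun x hx => ?_⟩
  · rw [← (hcurve s t _ rfl).1]
    simpa [hP, evalEval_C] using hst.1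
  · have := hst.2 x hx
    contrapose! this
    simp only [map_add, map_smul, smul_eq_mul] at this
    simp [hL, evalEval_C]
    linear_combination this

end IsFrame

theorem exists_isFrame [IsAlgClosed K] [CharZero K] (hT : IsNodalCubic T)
    (hV : Module.finrank K V = 5) (hp : p ≠ 0) (hs : ∀ w, T p p w = 0) :
    ∃ e₁ e₂ e₃ e₄, IsFrame T p e₁ e₂ e₃ e₄ := by
  have : FiniteDimensional K V := Module.finite_of_finrank_pos (by omega)
  let _ : Invertible (2 : K) := invertibleOfNonzero two_ne_zero
  obtain ⟨v₀, hv₀⟩ := LinearMap.BilinForm.exists_orthogonal_basis (B := T p)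
    ⟨fun x y => hT.swap_right p x y⟩
  obtain ⟨v, hv⟩ : ∃ v : Module.Basis (Fin 5) K V, ∀ i j, i ≠ j → T p (v i) (v j) = 0 :=
    ⟨v₀.reindex (finCongr hV), fun i j hij => by
      simpa using hv₀ (i := (finCongr hV).symm i) (j := (finCongr hV).symm j) (by simpa using hij)⟩
  have hker (i : Fin 5) (hi : T p (v i) (v i) = 0) : ∃ c : K, v i = c • p := by
    refine hT.nodal p hp hs _ fun w => ?_
    have : T p (v i) = 0 := v.ext fun j => by
      by_cases hij : i = j
      · subst hij; simpa using hi
      · simpa using hv i j hij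
    rw [this, LinearMap.zero_apply]
  obtain ⟨i, hi⟩ : ∃ i, T p (v i) (v i) = 0 := by
    obtain ⟨i, hi⟩ : ∃ i, v.repr p i ≠ 0 := by
      by_contra! h0
      exact hp (v.repr.map_eq_zero_iff.1 (Finsupp.ext h0))
    refine ⟨i, (mul_eq_zero.1 ?_).resolve_left hi⟩
    have h0 := hs (v i)
    rw [hT.swap_right] at h0
    nth_rewrite 2 [← v.sum_repr p] at h0
    rw [map_sum, Finset.sum_eq_single i] at h0
    · simpa using h0
    · intro j _ hj
      simp [hv i j hj.symm]
    · simp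
  obtain ⟨c, hc⟩ := hker i hi
  have hc0 : c ≠ 0 := by
    rintro rfl
    exact v.ne_zero i (by simpa using hc)
  have hne (j : Fin 5) (hj : j ≠ i) : T p (v j) (v j) ≠ 0 := by
    intro h0
    obtain ⟨c', hc'⟩ := hker j h0
    have : v j = (c' / c) • v i := by rw [hc, hc', smul_smul, div_mul_cancel₀ _ hc0]
    have := congrArg (fun x => v.repr x j) this
    simp [hj.symm] at this
  have hw (k : Fin 4) : ∃ r : K, r * r = T p (v (i.succAbove k)) (v (i.succAbove k)) ∧ r ≠ 0 := by
    obtain ⟨r, hr⟩ := IsAlgClosed.exists_eq_mul_self (T p (v (i.succAbove k)) (v (i.succAbove k)))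
    refine ⟨r, hr.symm, ?_⟩
    rintro rfl
    exact hne _ (Fin.succAbove_ne i k) (by simpa using hr)
  choose r hr hr0 using hw
  obtain ⟨w, hw⟩ : ∃ w : Fin 4 → V, ∀ k l, T p (w k) (w l) = if k = l then 1 else 0 := by
    refine ⟨fun k => (r k)⁻¹ • v (i.succAbove k), fun k l => ?_⟩
    split_ifs with hkl
    · subst hkl
      have := hr0 k
      simp [← hr]
      field_simp
    · simp [hv _ _ (fun h => hkl (Fin.succAbove_right_injective h))]
  obtain ⟨ι, hι⟩ := IsAlgClosed.exists_eq_mul_self (-1 : K)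
  refine ⟨w 0 + ι • w 1, w 2 + ι • w 3, (-1 / 2 : K) • (w 2 - ι • w 3),
    (1 / 2 : K) • (w 0 - ι • w 1), hp, hs, ?_, ?_, ?_, ?_, ?_, ?_, ?_, ?_, ?_, ?_⟩
  all_goals simp [hw]
  all_goals
    rw [← hι]
    norm_num

/-- A nodal cubic threefold has at most ten nodes, in terms of symmetric trilinear forms. -/
theorem card_nodes_le_ten [IsAlgClosed K] [CharZero K] (hT : IsNodalCubic T)
    (hV : Module.finrank K V = 5) (S : Finset (ℙ K V))
    (hS : ∀ x ∈ S, ∀ w, T x.rep x.rep w = 0) : S.card ≤ 10 := by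
  classical
  obtain rfl | ⟨y, hy⟩ := S.eq_empty_or_nonempty
  · simp
  obtain ⟨e₁, e₂, e₃, e₄, h⟩ := exists_isFrame hT hV y.rep_nonzero (hS y hy)
  obtain ⟨s, t, φ, hφ, hφ₁, hφ₂⟩ := h.exists_general_point hT hV
    ((S.erase y).image Projectivization.rep) (by
      intro x hx
      obtain ⟨z, hz, rfl⟩ := Finset.mem_image.1 hx
      by_contra! h0
      obtain ⟨c, hc⟩ := hT.nodal _ y.rep_nonzero (hS y hy) z.rep h0
      refine (Finset.mem_erase.1 hz).1 ?_
      rw [← z.mk_rep, ← y.mk_rep, Projectivization.mk_eq_mk_iff']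
      exact ⟨c, hc.symm⟩)
  have F := h.translate hT s t
  rw [← hφ] at F
  have := (F.flip hT).card_le_nine hT hV hφ₁ (S.erase y) fun x hx =>
    ⟨hS x (Finset.mem_of_mem_erase hx), hφ₂ _ (Finset.mem_image_of_mem _ hx)⟩
  rw [Finset.card_erase_of_mem hy] at this
  omega

end CountingNodes

section TrilinearFormOfCubic

variable {K : Type*} [Field K]

/-- The third partial derivatives of `f` at the origin, as a trilinear form. -/
noncomputable def thirdDerivForm (f : MvPolynomial (Fin 5) K) :
    (Fin 5 → K) →ₗ[K] (Fin 5 → K) →ₗ[K] (Fin 5 → K) →ₗ[K] K :=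
  ∑ i, ∑ j, ∑ k, (eval 0 (pderiv i (pderiv j (pderiv k f)))) •
    (LinearMap.proj i).smulRight ((LinearMap.proj j).smulRight
      (LinearMap.proj (R := K) (φ := fun _ : Fin 5 => K) k))

theorem thirdDerivForm_apply (f : MvPolynomial (Fin 5) K) (x y z : Fin 5 → K) :
    thirdDerivForm f x y z =
      ∑ i, ∑ j, ∑ k, eval 0 (pderiv i (pderiv j (pderiv k f))) * (x i * (y j * z k)) := by
  simp [thirdDerivForm]

theorem pderiv_pderiv_comm {σ R : Type*} [CommSemiring R] (i j : σ) (f : MvPolynomial σ R) :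
    pderiv i (pderiv j f) = pderiv j (pderiv i f) := by
  classical
  induction f using MvPolynomial.induction_on with
  | C a => simp
  | add p q hp hq => simp [hp, hq]
  | mul_X p k hp =>
    simp only [Derivation.leibniz, smul_eq_mul, map_add, hp, pderiv_X]
    have (l m : σ) : pderiv l ((Pi.single m 1 : σ → MvPolynomial σ R) k) = 0 := by
      rw [Pi.single_apply]; split_ifs <;> simp
    simp [this]
    ring

theorem thirdDerivForm_swap_left (f : MvPolynomial (Fin 5) K) (x y z : Fin 5 → K) :
    thirdDerivForm f x y z = thirdDerivForm f y x z := by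
  rw [thirdDerivForm_apply, thirdDerivForm_apply, Finset.sum_comm]
  refine Finset.sum_congr rfl fun i _ => Finset.sum_congr rfl fun j _ =>
    Finset.sum_congr rfl fun k _ => ?_
  rw [pderiv_pderiv_comm]
  ring

theorem thirdDerivForm_swap_right (f : MvPolynomial (Fin 5) K) (x y z : Fin 5 → K) :
    thirdDerivForm f x y z = thirdDerivForm f x z y := by
  rw [thirdDerivForm_apply, thirdDerivForm_apply]
  refine Finset.sum_congr rfl fun i _ => ?_
  rw [Finset.sum_comm]
  refine Finset.sum_congr rfl fun j _ => Finset.sum_congr rfl fun k _ => ?_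
  rw [pderiv_pderiv_comm j k]
  ring

theorem eval_pderiv_pderiv_of_cubic {f : MvPolynomial (Fin 5) K} (hf : f.IsHomogeneous 3)
    (v : Fin 5 → K) (j k : Fin 5) :
    eval v (pderiv j (pderiv k f)) = ∑ i, v i * eval 0 (pderiv i (pderiv j (pderiv k f))) := by
  have h1 : (pderiv j (pderiv k f)).IsHomogeneous 1 := hf.pderiv.pderiv
  have h0 (i : Fin 5) : eval v (pderiv i (pderiv j (pderiv k f))) =
      eval 0 (pderiv i (pderiv j (pderiv k f))) := by
    have h0 : (pderiv i (pderiv j (pderiv k f))).IsHomogeneous 0 := h1.pderiv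
    rw [← totalDegree_zero_iff_isHomogeneous, totalDegree_eq_zero_iff_eq_C] at h0
    rw [h0, eval_C, eval_C]
  have := congrArg (eval v) h1.sum_X_mul_pderiv
  simp only [map_sum, map_mul, eval_X, h0, one_smul] at this
  exact this.symm

theorem thirdDerivForm_eq_hess {f : MvPolynomial (Fin 5) K} (hf : f.IsHomogeneous 3)
    (v x y : Fin 5 → K) :
    thirdDerivForm f v x y = ∑ j, ∑ k, eval v (pderiv j (pderiv k f)) * (x j * y k) := by
  rw [thirdDerivForm_apply, Finset.sum_comm]
  refine Finset.sum_congr rfl fun j _ => ?_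
  rw [Finset.sum_comm]
  refine Finset.sum_congr rfl fun k _ => ?_
  rw [eval_pderiv_pderiv_of_cubic hf, Finset.sum_mul]
  exact Finset.sum_congr rfl fun i _ => by ring

theorem thirdDerivForm_eq_grad {f : MvPolynomial (Fin 5) K} (hf : f.IsHomogeneous 3)
    (v y : Fin 5 → K) :
    thirdDerivForm f v v y = ∑ k, 2 * eval v (pderiv k f) * y k := by
  rw [thirdDerivForm_eq_hess hf, Finset.sum_comm]
  refine Finset.sum_congr rfl fun k _ => ?_
  have h2 : (pderiv k f).IsHomogeneous 2 := hf.pderiv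
  have := congrArg (eval v) h2.sum_X_mul_pderiv
  simp at this
  rw [← this, Finset.sum_mul]
  exact Finset.sum_congr rfl fun i _ => by ring

theorem thirdDerivForm_self_eq_zero_iff [CharZero K] {f : MvPolynomial (Fin 5) K}
    (hf : f.IsHomogeneous 3) (v : Fin 5 → K) :
    (∀ w, thirdDerivForm f v v w = 0) ↔ ∀ i, eval v (pderiv i f) = 0 := by
  simp only [thirdDerivForm_eq_grad hf]
  constructor
  · intro h i
    simpa [Pi.single_apply] using h (Pi.single i 1)
  · intro h w
    simp [h]

theorem mulVec_hess_eq_zero {f : MvPolynomial (Fin 5) K} (hf : f.IsHomogeneous 3)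
    {v x : Fin 5 → K} (h : ∀ w, thirdDerivForm f v x w = 0) :
    (Matrix.of fun i j : Fin 5 => eval v (pderiv i (pderiv j f))).mulVec x = 0 := by
  ext i
  have := h (Pi.single i 1)
  rw [thirdDerivForm_eq_hess hf] at this
  simp only [Matrix.mulVec, dotProduct, Matrix.of_apply, Pi.zero_apply]
  rw [← this]
  refine Finset.sum_congr rfl fun j _ => ?_
  rw [Finset.sum_eq_single i]
  · simp [pderiv_pderiv_comm i j]
  · intro k _ hk
    simp [hk]
  · simp

theorem exists_eq_smul_of_rank_eq_four {M : Matrix (Fin 5) (Fin 5) K} (hM : M.rank = 4)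
    {v x : Fin 5 → K} (hv : v ≠ 0) (hMv : M.mulVec v = 0) (hMx : M.mulVec x = 0) :
    ∃ c : K, x = c • v := by
  have h := M.mulVecLin.finrank_range_add_finrank_ker
  rw [← Matrix.rank, hM, Module.finrank_fin_fun] at h
  have h1 : Module.finrank K (LinearMap.ker M.mulVecLin) = 1 := by omega
  obtain ⟨c, hc⟩ := (finrank_eq_one_iff_of_nonzero' (⟨v, hMv⟩ : LinearMap.ker M.mulVecLin)
    (fun h0 => hv (congrArg Subtype.val h0))).1 h1 ⟨x, hMx⟩
  exact ⟨c, by simpa using (congrArg Subtype.val hc).symm⟩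

end TrilinearFormOfCubic

/-- A nodal cubic threefold `X ⊂ ℙ⁴` has at most `10` nodes.
Here `X` is the zero locus in `ℙ⁴` of an irreducible homogeneous cubic `f` over an
algebraically closed field of characteristic zero, whose only singularities are ordinary
double points: at every singular point (nonzero vector at which all partials of `f`
vanish) the Hessian matrix of `f` has rank `4` (corank one, i.e. an `A₁`-singularity of
the threefold).  Then the set of singular points of `X` in `ℙ⁴` is finite of cardinality
at most `10`. -/
theorem nodal_cubic_threefold_at_most_ten_nodes
    (K : Type*) [Field K] [IsAlgClosed K] [CharZero K]
    (f : MvPolynomial (Fin 5) K)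
    (hf3 : f.IsHomogeneous 3) (hirr : Irreducible f)
    (hnodal : ∀ v : Fin 5 → K, v ≠ 0 →
      (∀ i : Fin 5, eval v (pderiv i f) = 0) →
      (Matrix.of fun i j : Fin 5 => eval v (pderiv i (pderiv j f))).rank = 4) :
    letI N : Set (ℙ K (Fin 5 → K)) :=
      {p | ∀ i : Fin 5, eval p.rep (pderiv i f) = 0}
    N.Finite ∧ N.ncard ≤ 10 := by
  have hT : IsNodalCubic (thirdDerivForm f) :=
    ⟨thirdDerivForm_swap_left f, thirdDerivForm_swap_right f, fun v hv hs x hx =>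
      exists_eq_smul_of_rank_eq_four
        (hnodal v hv ((thirdDerivForm_self_eq_zero_iff hf3 v).1 hs)) hv
        (mulVec_hess_eq_zero hf3 hs) (mulVec_hess_eq_zero hf3 hx)⟩
  have hcard (S : Finset (ℙ K (Fin 5 → K)))
      (hS : (S : Set (ℙ K (Fin 5 → K))) ⊆ {p | ∀ i : Fin 5, eval p.rep (pderiv i f) = 0}) :
      S.card ≤ 10 :=
    card_nodes_le_ten hT (by simp) S fun x hx =>
      (thirdDerivForm_self_eq_zero_iff hf3 _).2 (hS hx)
  have hfin : {p : ℙ K (Fin 5 → K) | ∀ i : Fin 5, eval p.rep (pderiv i f) = 0}.Finite := by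
    by_contra hinf
    obtain ⟨S, hS, hS'⟩ := Set.Infinite.exists_subset_card_eq hinf 11
    have := hcard S hS
    omega
  refine ⟨hfin, ?_⟩
  rw [Set.ncard_eq_toFinset_card _ hfin]
  exact hcard _ (by simp)
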